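/- arXiv:2010.12340 — 6 statements merged into one kernel-verified Lean document; each statement's English description precedes it below -/
import Mathlib

section
/- Let m and n be positive integers with m < n and m odd, and let α be an arbitrary real number. Then ∑_{k=1}^{n} cos^m(α − (k−1)·2π/n) = 0. -/
/-- The exponentials of frequency `l`, sampled at `n` equally spaced points of the circle, sum to
zero when `n ∤ l`. -/
theorem sum_exp_equally_spaced_eq_zero {n : ℕ} (hn : n ≠ 0) {l : ℤ} (hl : ¬ (n : ℤ) ∣ l) (a : ℂ) :
    ∑ k ∈ Finset.range n, Complex.exp (l * ((a - k * (2 * Real.pi / n)) * Complex.I)) = 0 := by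
  have hn' : (n : ℂ) ≠ 0 := Nat.cast_ne_zero.mpr hn
  set w := Complex.exp (-l * (2 * Real.pi / n) * Complex.I) with hw
  have hw_ne : w ≠ 1 := by
    rw [hw, Ne, Complex.exp_eq_one_iff]
    rintro ⟨q, hq⟩
    refine hl ⟨-q, ?_⟩
    have hc : (2 * Real.pi * Complex.I : ℂ) * l = (2 * Real.pi * Complex.I) * (n * -q) := by
      field_simp at hq
      linear_combination (-2 * Real.pi * Complex.I : ℂ) * hq
    exact_mod_cast mul_left_cancel₀ Complex.two_pi_I_ne_zero hc
  have hw_pow : w ^ n = 1 := by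
    rw [hw, ← Complex.exp_nat_mul, Complex.exp_eq_one_iff]
    refine ⟨-l, ?_⟩
    push_cast
    field_simp
  have hterm (k : ℕ) : Complex.exp (l * ((a - k * (2 * Real.pi / n)) * Complex.I)) =
      Complex.exp (l * (a * Complex.I)) * w ^ k := by
    rw [hw, ← Complex.exp_nat_mul, ← Complex.exp_add]
    ring_nf
  simp_rw [hterm, ← Finset.mul_sum, geom_sum_eq hw_ne, hw_pow, sub_self, zero_div, mul_zero]

theorem Complex.cos_pow_eq_sum_exp (m : ℕ) (x : ℂ) :
    Complex.cos x ^ m = (∑ j ∈ Finset.range (m + 1),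
      (m.choose j : ℂ) * Complex.exp (((2 * j - m : ℤ) : ℂ) * (x * Complex.I))) / 2 ^ m := by
  rw [Complex.cos, div_pow, add_pow]
  congr 1
  refine Finset.sum_congr rfl fun j hj => ?_
  have hjm : j ≤ m := Nat.lt_succ_iff.mp (Finset.mem_range.mp hj)
  rw [← Complex.exp_nat_mul, ← Complex.exp_nat_mul, ← Complex.exp_add, mul_comm]
  push_cast [Nat.cast_sub hjm]
  ring_nf

/-- For positive integers `m < n` with `m` odd and any real `α`,
`∑_{k=1}^{n} cos^m (α - (k-1)·2π/n) = 0`. -/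
theorem sum_cos_pow_odd_eq_zero (m n : ℕ) (hm : 0 < m) (hmn : m < n) (hodd : Odd m) (α : ℝ) :
    ∑ k ∈ Finset.range n, (Real.cos (α - (k : ℝ) * (2 * Real.pi / n))) ^ m = 0 := by
  apply Complex.ofReal_injective
  push_cast
  simp_rw [Complex.cos_pow_eq_sum_exp]
  rw [← Finset.sum_div, Finset.sum_comm]
  refine div_eq_zero_iff.mpr (Or.inl (Finset.sum_eq_zero fun j hj => ?_))
  have hjm : j ≤ m := Nat.lt_succ_iff.mp (Finset.mem_range.mp hj)
  have hl : ¬ (n : ℤ) ∣ 2 * j - m := by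
    intro h
    have h0 := Int.eq_zero_of_abs_lt_dvd h (by rw [abs_lt]; lia)
    obtain ⟨r, hr⟩ := hodd
    lia
  rw [← Finset.mul_sum, sum_exp_equally_spaced_eq_zero (by lia) hl, mul_zero]
end

section
/- Let m and n be positive integers with m < n and m even, and let α be an arbitrary real number. Then ∑_{k=1}^{n} cos^m(α − (k−1)·2π/n) = n · C(m, m/2) / 2^m, where C(m, m/2) is the binomial coefficient. -/
theorem IsPrimitiveRoot.sum_zpow_pow_range {K : Type*} [Field K] {ζ : K} {n : ℕ}
    (hζ : IsPrimitiveRoot ζ n) (d : ℤ) :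
    ∑ k ∈ Finset.range n, (ζ ^ d) ^ k = if (n : ℤ) ∣ d then (n : K) else 0 := by
  split_ifs with h
  · simp [(hζ.zpow_eq_one_iff_dvd d).2 h]
  · have h1 : ζ ^ d ≠ 1 := fun h' => h ((hζ.zpow_eq_one_iff_dvd d).1 h')
    rw [geom_sum_eq h1, ← zpow_natCast (ζ ^ d), zpow_comm, zpow_natCast, hζ.pow_eq_one, one_zpow,
      sub_self, zero_div]

theorem IsPrimitiveRoot.sum_add_inv_pow_two_mul {K : Type*} [Field K] {ζ w : K} {n p : ℕ}
    (hζ : IsPrimitiveRoot ζ n) (hw : w ≠ 0) (hp : 2 * p < n) :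
    ∑ k ∈ Finset.range n, (w * (ζ ^ k)⁻¹ + w⁻¹ * ζ ^ k) ^ (2 * p) =
      n * ((2 * p).choose p : K) := by
  have hζ0 : ζ ≠ 0 := hζ.ne_zero (by omega)
  have expand : ∀ k ∈ Finset.range n, (w * (ζ ^ k)⁻¹ + w⁻¹ * ζ ^ k) ^ (2 * p) =
      ∑ j ∈ Finset.range (2 * p + 1), w ^ (2 * j - 2 * p : ℤ) * ((2 * p).choose j : K) *
        (ζ ^ (2 * p - 2 * j : ℤ)) ^ k := by
    intro k _
    rw [add_pow]
    refine Finset.sum_congr rfl fun j hj => ?_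
    have hj' : j ≤ 2 * p := Nat.lt_succ_iff.1 (Finset.mem_range.1 hj)
    have hterm : ∀ x : K, x ≠ 0 →
        x ^ j * x⁻¹ ^ (2 * p - j) = x ^ (2 * j - 2 * p : ℤ) := by
      intro x hx
      rw [← zpow_natCast, ← zpow_natCast, inv_zpow', ← zpow_add₀ hx]
      congr 1
      omega
    have hx : w * (ζ ^ k)⁻¹ ≠ 0 := mul_ne_zero hw (inv_ne_zero (pow_ne_zero _ hζ0))
    have hinv : w⁻¹ * ζ ^ k = (w * (ζ ^ k)⁻¹)⁻¹ := by rw [mul_inv, inv_inv]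
    rw [hinv, hterm _ hx, mul_zpow, inv_zpow', neg_sub, ← zpow_natCast ζ k, zpow_comm,
      zpow_natCast]
    ring
  rw [Finset.sum_congr rfl expand, Finset.sum_comm]
  simp_rw [← Finset.mul_sum, hζ.sum_zpow_pow_range]
  rw [Finset.sum_eq_single p]
  · simp [mul_comm]
  · intro j hj hjp
    have hj' := Finset.mem_range.1 hj
    rw [if_neg, mul_zero]
    intro hdvd
    have := Int.eq_zero_of_abs_lt_dvd hdvd (by rw [abs_lt]; constructor <;> omega)
    omega
  · intro h
    exact absurd (Finset.mem_range.2 (by omega)) h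


/-- For positive integers `m < n` with `m` even and any real `α`,
`∑_{k=1}^{n} cos^m (α - (k-1)·2π/n) = n · C(m, m/2) / 2^m`. -/
theorem sum_cos_pow_even (m n : ℕ) (hm : 0 < m) (hmn : m < n) (heven : Even m) (α : ℝ) :
    ∑ k ∈ Finset.range n, (Real.cos (α - (k : ℝ) * (2 * Real.pi / n))) ^ m =
      (n : ℝ) * (m.choose (m / 2)) / 2 ^ m := by
  obtain ⟨p, rfl⟩ := heven.two_dvd
  have hn : n ≠ 0 := by omega
  have key := (Complex.isPrimitiveRoot_exp n hn).sum_add_inv_pow_two_mul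
    (Complex.exp_ne_zero (α * Complex.I)) hmn
  have hcos : ∀ k : ℕ, Complex.exp (α * Complex.I) *
      (Complex.exp (2 * Real.pi * Complex.I / n) ^ k)⁻¹ + (Complex.exp (α * Complex.I))⁻¹ *
      Complex.exp (2 * Real.pi * Complex.I / n) ^ k =
      2 * (Real.cos (α - (k : ℝ) * (2 * Real.pi / n)) : ℂ) := by
    intro k
    rw [Complex.ofReal_cos, Complex.two_cos, ← Complex.exp_nat_mul, ← Complex.exp_neg,
      ← Complex.exp_neg, ← Complex.exp_add, ← Complex.exp_add]
    push_cast
    congr 2 <;> ring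
  simp_rw [hcos, mul_pow, ← Finset.mul_sum] at key
  rw [Nat.mul_div_cancel_left p two_pos, eq_div_iff (by positivity), mul_comm]
  exact_mod_cast key
end

section
/- Let c > 0 and let the regular octahedron have vertices (±c,0,0), (0,±c,0), (0,0,±c) in ℝ³, so its circumradius is R = c. For an arbitrary point M = (x,y,z) ∈ ℝ³ with L = √(x² + y² + z²) its distance to the centroid (origin), the distances d_1,…,d_6 from M to the six vertices satisfy ∑_{i=1}^{6} d_i⁶ = 6·((R² + L²)³ + 4·R²·L²·(R² + L²)). -/
/-- For the regular octahedron with vertices `(±c,0,0), (0,±c,0), (0,0,±c)`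
(circumradius `R = c`) and an arbitrary point `M = (x,y,z)` at distance `L` from the
centroid, `∑ dᵢ⁶ = 6((R² + L²)³ + 4R²L²(R² + L²))`. -/
theorem octahedron_sixth_power_sum (c : ℝ) (hc : 0 < c) (x y z : ℝ) :
    let R : ℝ := c
    let L : ℝ := Real.sqrt (x ^ 2 + y ^ 2 + z ^ 2)
    let d : ℝ → ℝ → ℝ → ℝ := fun a b e =>
      Real.sqrt ((x - a) ^ 2 + (y - b) ^ 2 + (z - e) ^ 2)
    d c 0 0 ^ 6 + d (-c) 0 0 ^ 6 + d 0 c 0 ^ 6 + d 0 (-c) 0 ^ 6 +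
        d 0 0 c ^ 6 + d 0 0 (-c) ^ 6 =
      6 * ((R ^ 2 + L ^ 2) ^ 3 + 4 * R ^ 2 * L ^ 2 * (R ^ 2 + L ^ 2)) := by
  intro R L d
  have hL : L ^ 2 = x ^ 2 + y ^ 2 + z ^ 2 := Real.sq_sqrt (by positivity)
  have hd (a b e : ℝ) : d a b e ^ 6 = ((x - a) ^ 2 + (y - b) ^ 2 + (z - e) ^ 2) ^ 3 := by
    rw [show d a b e ^ 6 = (d a b e ^ 2) ^ 3 by ring]
    exact congrArg (· ^ 3) (Real.sq_sqrt (by positivity))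
  simp only [hd, hL, R]
  ring
end

section
/- Let c > 0 and let the cube have the eight vertices (±c,±c,±c) in ℝ³ (all sign combinations), so its circumradius is R = √3·c. For an arbitrary point M = (x,y,z) ∈ ℝ³ with L = √(x² + y² + z²) its distance to the centroid (origin), the distances d_1,…,d_8 from M to the eight vertices satisfy ∑_{i=1}^{8} d_i⁶ = 8·((R² + L²)³ + 4·R²·L²·(R² + L²)). -/
theorem Real.sqrt_pow_six {t : ℝ} (ht : 0 ≤ t) : Real.sqrt t ^ 6 = t ^ 3 := by
  rw [show 6 = 2 * 3 from rfl, pow_mul, Real.sq_sqrt ht]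

/-- For the cube with the eight vertices `(±c,±c,±c)` (circumradius `R = √3 c`) and an
arbitrary point `M = (x,y,z)` at distance `L` from the centroid,
`∑ dᵢ⁶ = 8((R² + L²)³ + 4R²L²(R² + L²))`. -/
theorem cube_sixth_power_sum (c : ℝ) (hc : 0 < c) (x y z : ℝ) :
    let R : ℝ := Real.sqrt 3 * c
    let L : ℝ := Real.sqrt (x ^ 2 + y ^ 2 + z ^ 2)
    let d : ℝ → ℝ → ℝ → ℝ := fun a b e =>
      Real.sqrt ((x - a) ^ 2 + (y - b) ^ 2 + (z - e) ^ 2)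
    d c c c ^ 6 + d c c (-c) ^ 6 + d c (-c) c ^ 6 + d c (-c) (-c) ^ 6 +
        d (-c) c c ^ 6 + d (-c) c (-c) ^ 6 + d (-c) (-c) c ^ 6 + d (-c) (-c) (-c) ^ 6 =
      8 * ((R ^ 2 + L ^ 2) ^ 3 + 4 * R ^ 2 * L ^ 2 * (R ^ 2 + L ^ 2)) := by
  intro R L d
  have hR : R ^ 2 = 3 * c ^ 2 := by
    rw [mul_pow, Real.sq_sqrt (by norm_num)]
  have hL : L ^ 2 = x ^ 2 + y ^ 2 + z ^ 2 := Real.sq_sqrt (by positivity)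
  have hd (a b e : ℝ) : d a b e ^ 6 = ((x - a) ^ 2 + (y - b) ^ 2 + (z - e) ^ 2) ^ 3 :=
    Real.sqrt_pow_six (by positivity)
  simp only [hd, hR, hL]
  ring
end

section
/- Let c > 0, let φ = (1+√5)/2 be the golden ratio, and let the regular icosahedron have the twelve vertices (0,±c,±cφ), (±c,±cφ,0), (±cφ,0,±c) in ℝ³ (all sign combinations), so its circumradius satisfies R² = c²(1+φ²). For an arbitrary point M = (x,y,z) ∈ ℝ³ with L = √(x² + y² + z²) its distance to the centroid (origin), the distances d_1,…,d_12 from M to the twelve vertices satisfy ∑_{i=1}^{12} d_i^{10} = 12·((R² + L²)⁵ + (40/3)·R²·L²·(R² + L²)³ + 16·R⁴·L⁴·(R² + L²)). -/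
theorem antipodal_fifth_powers_sum (A t : ℝ) :
    (A - t) ^ 5 + (A + t) ^ 5 = 2 * A ^ 5 + 20 * A ^ 3 * t ^ 2 + 10 * A * t ^ 4 := by
  ring

theorem icosahedron_axes_sq_sum (c φ x y z : ℝ) :
    (c * (y + φ * z)) ^ 2 + (c * (y - φ * z)) ^ 2 + (c * (x + φ * y)) ^ 2 +
        (c * (x - φ * y)) ^ 2 + (c * (z + φ * x)) ^ 2 + (c * (z - φ * x)) ^ 2 =
      2 * (c ^ 2 * (1 + φ ^ 2)) * (x ^ 2 + y ^ 2 + z ^ 2) := by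
  ring

theorem icosahedron_axes_fourth_power_sum (c φ x y z : ℝ) (hφ : φ ^ 2 = φ + 1) :
    (c * (y + φ * z)) ^ 4 + (c * (y - φ * z)) ^ 4 + (c * (x + φ * y)) ^ 4 +
        (c * (x - φ * y)) ^ 4 + (c * (z + φ * x)) ^ 4 + (c * (z - φ * x)) ^ 4 =
      6 / 5 * (c ^ 2 * (1 + φ ^ 2)) ^ 2 * (x ^ 2 + y ^ 2 + z ^ 2) ^ 2 := by
  have h4 : φ ^ 4 = 3 * φ + 2 := by linear_combination (φ ^ 2 + φ + 2) * hφ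
  have hsum : 1 + φ ^ 4 = 3 / 5 * (1 + φ ^ 2) ^ 2 := by
    linear_combination 2 / 5 * h4 - 6 / 5 * hφ
  have hmix : 12 * φ ^ 2 = 12 / 5 * (1 + φ ^ 2) ^ 2 := by
    linear_combination -12 / 5 * h4 + 36 / 5 * hφ
  linear_combination 2 * c ^ 4 * (x ^ 4 + y ^ 4 + z ^ 4) * hsum +
    c ^ 4 * (x ^ 2 * y ^ 2 + y ^ 2 * z ^ 2 + z ^ 2 * x ^ 2) * hmix

theorem sqrt_pow_ten {a : ℝ} (ha : 0 ≤ a) : Real.sqrt a ^ 10 = a ^ 5 := by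
  rw [show (10 : ℕ) = 2 * 5 from rfl, pow_mul, Real.sq_sqrt ha]

/-- The tenth powers of the distances from `(x, y, z)` to two antipodal points. -/
theorem antipodal_tenth_powers_sum (x y z a b e A t : ℝ)
    (hA : A = a ^ 2 + b ^ 2 + e ^ 2 + (x ^ 2 + y ^ 2 + z ^ 2))
    (ht : t = x * a + y * b + z * e) :
    Real.sqrt ((x - a) ^ 2 + (y - b) ^ 2 + (z - e) ^ 2) ^ 10 +
        Real.sqrt ((x - -a) ^ 2 + (y - -b) ^ 2 + (z - -e) ^ 2) ^ 10 =
      2 * A ^ 5 + 80 * A ^ 3 * t ^ 2 + 160 * A * t ^ 4 := by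
  rw [sqrt_pow_ten (by positivity), sqrt_pow_ten (by positivity),
    show (x - a) ^ 2 + (y - b) ^ 2 + (z - e) ^ 2 = A - 2 * t by rw [hA, ht]; ring,
    show (x - -a) ^ 2 + (y - -b) ^ 2 + (z - -e) ^ 2 = A + 2 * t by rw [hA, ht]; ring,
    antipodal_fifth_powers_sum]
  ring


/-- For the regular icosahedron with the twelve vertices `(0,±c,±cφ), (±c,±cφ,0),
(±cφ,0,±c)` (`φ` the golden ratio, circumradius `R` with `R² = c²(1+φ²)`) and an
arbitrary point `M = (x,y,z)` at distance `L` from the centroid,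
`∑ dᵢ¹⁰ = 12((R² + L²)⁵ + (40/3)R²L²(R² + L²)³ + 16R⁴L⁴(R² + L²))`. -/
theorem icosahedron_tenth_power_sum (c : ℝ) (hc : 0 < c) (φ : ℝ)
    (hφ : φ = (1 + Real.sqrt 5) / 2) (R : ℝ) (hR : 0 ≤ R)
    (hR2 : R ^ 2 = c ^ 2 * (1 + φ ^ 2)) (x y z : ℝ) :
    let L : ℝ := Real.sqrt (x ^ 2 + y ^ 2 + z ^ 2)
    let d : ℝ → ℝ → ℝ → ℝ := fun a b e =>
      Real.sqrt ((x - a) ^ 2 + (y - b) ^ 2 + (z - e) ^ 2)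
    d 0 c (c * φ) ^ 10 + d 0 c (-(c * φ)) ^ 10 +
        d 0 (-c) (c * φ) ^ 10 + d 0 (-c) (-(c * φ)) ^ 10 +
        d c (c * φ) 0 ^ 10 + d c (-(c * φ)) 0 ^ 10 +
        d (-c) (c * φ) 0 ^ 10 + d (-c) (-(c * φ)) 0 ^ 10 +
        d (c * φ) 0 c ^ 10 + d (c * φ) 0 (-c) ^ 10 +
        d (-(c * φ)) 0 c ^ 10 + d (-(c * φ)) 0 (-c) ^ 10 =
      12 * ((R ^ 2 + L ^ 2) ^ 5 + 40 / 3 * R ^ 2 * L ^ 2 * (R ^ 2 + L ^ 2) ^ 3 +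
        16 * R ^ 4 * L ^ 4 * (R ^ 2 + L ^ 2)) := by
  intro L d
  have hφ2 : φ ^ 2 = φ + 1 := by
    rw [hφ]
    linear_combination 1 / 4 * Real.sq_sqrt (show (0 : ℝ) ≤ 5 by norm_num)
  have hL : L ^ 2 = x ^ 2 + y ^ 2 + z ^ 2 := Real.sq_sqrt (by positivity)
  have hL4 : L ^ 4 = (x ^ 2 + y ^ 2 + z ^ 2) ^ 2 := by rw [← hL]; ring
  have hR4 : R ^ 4 = (c ^ 2 * (1 + φ ^ 2)) ^ 2 := by rw [← hR2]; ring
  have h2 := icosahedron_axes_sq_sum c φ x y z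
  have h4 := icosahedron_axes_fourth_power_sum c φ x y z hφ2
  rw [hL4, hR4, hL, hR2]
  obtain ⟨A, hA⟩ : ∃ A, A = c ^ 2 * (1 + φ ^ 2) + (x ^ 2 + y ^ 2 + z ^ 2) := ⟨_, rfl⟩
  have yz_add := antipodal_tenth_powers_sum x y z 0 c (c * φ) A (c * (y + φ * z))
    (by rw [hA]; ring) (by ring)
  have yz_sub := antipodal_tenth_powers_sum x y z 0 c (-(c * φ)) A (c * (y - φ * z))
    (by rw [hA]; ring) (by ring)
  have xy_add := antipodal_tenth_powers_sum x y z c (c * φ) 0 A (c * (x + φ * y))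
    (by rw [hA]; ring) (by ring)
  have xy_sub := antipodal_tenth_powers_sum x y z c (-(c * φ)) 0 A (c * (x - φ * y))
    (by rw [hA]; ring) (by ring)
  have zx_add := antipodal_tenth_powers_sum x y z (c * φ) 0 c A (c * (z + φ * x))
    (by rw [hA]; ring) (by ring)
  have zx_sub := antipodal_tenth_powers_sum x y z (-(c * φ)) 0 c A (c * (z - φ * x))
    (by rw [hA]; ring) (by ring)
  simp only [neg_neg, neg_zero] at yz_add yz_sub xy_add xy_sub zx_add zx_sub
  rw [← hA]
  simp only [d]
  linear_combination yz_add + yz_sub + xy_add + xy_sub + zx_add + zx_sub + 80 * A ^ 3 * h2 + 160 * A * h4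
end

section
/- Let c > 0, let φ = (1+√5)/2 be the golden ratio, and let the regular dodecahedron have the twenty vertices (±c,±c,±c) (all eight sign combinations) together with (0,±c/φ,±cφ), (±c/φ,±cφ,0), (±cφ,0,±c/φ) (all sign combinations) in ℝ³, so its circumradius is R = √3·c. For an arbitrary point M = (x,y,z) ∈ ℝ³ with L = √(x² + y² + z²) its distance to the centroid (origin), the distances d_1,…,d_20 from M to the twenty vertices satisfy ∑_{i=1}^{20} d_i^{10} = 20·((R² + L²)⁵ + (40/3)·R²·L²·(R² + L²)³ + 16·R⁴·L⁴·(R² + L²)). -/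
/-- The tenth power of the distance from `(x,y,z)` to a point of the sphere `a² + b² + e² = r`,
in terms of the inner product of the two points. -/
theorem sqrt_dist_sq_pow_ten (x y z r a b e : ℝ) (h : a ^ 2 + b ^ 2 + e ^ 2 = r) :
    Real.sqrt ((x - a) ^ 2 + (y - b) ^ 2 + (z - e) ^ 2) ^ 10 =
      (r + (x ^ 2 + y ^ 2 + z ^ 2) - 2 * (a * x + b * y + e * z)) ^ 5 := by
  rw [show 10 = 2 * 5 from rfl, pow_mul, Real.sq_sqrt (by positivity), ← h]
  ring

/-- The tenth power sum over the vertices of a dodecahedron, with the quantity `r + x² + y² + z²`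
replaced by an indeterminate `S`. Only the second and fourth moments of the vertices matter. -/
theorem dodecahedron_sum_fifth_powers (c p q x y z S : ℝ) (hsum : p ^ 2 + q ^ 2 = 3 * c ^ 2)
    (hmul : p * q = c ^ 2) :
    (S - 2 * (c * x + c * y + c * z)) ^ 5 + (S - 2 * (c * x + c * y + (-c) * z)) ^ 5 +
        (S - 2 * (c * x + (-c) * y + c * z)) ^ 5 + (S - 2 * (c * x + (-c) * y + (-c) * z)) ^ 5 +
        (S - 2 * ((-c) * x + c * y + c * z)) ^ 5 + (S - 2 * ((-c) * x + c * y + (-c) * z)) ^ 5 +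
        (S - 2 * ((-c) * x + (-c) * y + c * z)) ^ 5 + (S - 2 * ((-c) * x + (-c) * y + (-c) * z)) ^ 5 +
        (S - 2 * (0 * x + p * y + q * z)) ^ 5 + (S - 2 * (0 * x + p * y + (-q) * z)) ^ 5 +
        (S - 2 * (0 * x + (-p) * y + q * z)) ^ 5 + (S - 2 * (0 * x + (-p) * y + (-q) * z)) ^ 5 +
        (S - 2 * (p * x + q * y + 0 * z)) ^ 5 + (S - 2 * (p * x + (-q) * y + 0 * z)) ^ 5 +
        (S - 2 * ((-p) * x + q * y + 0 * z)) ^ 5 + (S - 2 * ((-p) * x + (-q) * y + 0 * z)) ^ 5 +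
        (S - 2 * (q * x + 0 * y + p * z)) ^ 5 + (S - 2 * (q * x + 0 * y + (-p) * z)) ^ 5 +
        (S - 2 * ((-q) * x + 0 * y + p * z)) ^ 5 + (S - 2 * ((-q) * x + 0 * y + (-p) * z)) ^ 5 =
      20 * (S ^ 5 + 40 * c ^ 2 * (x ^ 2 + y ^ 2 + z ^ 2) * S ^ 3 +
        144 * c ^ 4 * (x ^ 2 + y ^ 2 + z ^ 2) ^ 2 * S) := by
  have hmul_sq : p ^ 2 * q ^ 2 = c ^ 4 := by
    rw [← mul_pow, hmul]
    ring
  have hsum_four : p ^ 4 + q ^ 4 = 7 * c ^ 4 := by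
    linear_combination (p ^ 2 + q ^ 2 + 3 * c ^ 2) * hsum - 2 * hmul_sq
  linear_combination 160 * S ^ 3 * (x ^ 2 + y ^ 2 + z ^ 2) * hsum +
    320 * S * (x ^ 4 + y ^ 4 + z ^ 4) * hsum_four +
    1920 * S * (x ^ 2 * y ^ 2 + y ^ 2 * z ^ 2 + z ^ 2 * x ^ 2) * hmul_sq

/-- For the regular dodecahedron with the twenty vertices `(±c,±c,±c)`,
`(0,±c/φ,±cφ), (±c/φ,±cφ,0), (±cφ,0,±c/φ)` (`φ` the golden ratio, circumradius
`R = √3 c`) and an arbitrary point `M = (x,y,z)` at distance `L` from the centroid,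
`∑ dᵢ¹⁰ = 20((R² + L²)⁵ + (40/3)R²L²(R² + L²)³ + 16R⁴L⁴(R² + L²))`. -/
theorem dodecahedron_tenth_power_sum (c : ℝ) (hc : 0 < c) (φ : ℝ)
    (hφ : φ = (1 + Real.sqrt 5) / 2) (x y z : ℝ) :
    let R : ℝ := Real.sqrt 3 * c
    let L : ℝ := Real.sqrt (x ^ 2 + y ^ 2 + z ^ 2)
    let d : ℝ → ℝ → ℝ → ℝ := fun a b e =>
      Real.sqrt ((x - a) ^ 2 + (y - b) ^ 2 + (z - e) ^ 2)
    d c c c ^ 10 + d c c (-c) ^ 10 + d c (-c) c ^ 10 + d c (-c) (-c) ^ 10 +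
        d (-c) c c ^ 10 + d (-c) c (-c) ^ 10 + d (-c) (-c) c ^ 10 + d (-c) (-c) (-c) ^ 10 +
        d 0 (c / φ) (c * φ) ^ 10 + d 0 (c / φ) (-(c * φ)) ^ 10 +
        d 0 (-(c / φ)) (c * φ) ^ 10 + d 0 (-(c / φ)) (-(c * φ)) ^ 10 +
        d (c / φ) (c * φ) 0 ^ 10 + d (c / φ) (-(c * φ)) 0 ^ 10 +
        d (-(c / φ)) (c * φ) 0 ^ 10 + d (-(c / φ)) (-(c * φ)) 0 ^ 10 +
        d (c * φ) 0 (c / φ) ^ 10 + d (c * φ) 0 (-(c / φ)) ^ 10 +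
        d (-(c * φ)) 0 (c / φ) ^ 10 + d (-(c * φ)) 0 (-(c / φ)) ^ 10 =
      20 * ((R ^ 2 + L ^ 2) ^ 5 + 40 / 3 * R ^ 2 * L ^ 2 * (R ^ 2 + L ^ 2) ^ 3 +
        16 * R ^ 4 * L ^ 4 * (R ^ 2 + L ^ 2)) := by
  intro R L d
  have hφ_sq : φ ^ 2 = φ + 1 := by
    subst hφ
    linear_combination Real.sq_sqrt (show (0 : ℝ) ≤ 5 by norm_num) / 4
  have hφ_ne : φ ≠ 0 := by
    rintro rfl
    norm_num at hφ_sq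
  have hR : R ^ 2 = 3 * c ^ 2 := by
    rw [mul_pow, Real.sq_sqrt (by norm_num)]
  have hL : L ^ 2 = x ^ 2 + y ^ 2 + z ^ 2 := Real.sq_sqrt (by positivity)
  have hdiv : c / φ = c * (φ - 1) := by
    rw [div_eq_iff hφ_ne]
    linear_combination -c * hφ_sq
  have hmul : c / φ * (c * φ) = c ^ 2 := by
    field_simp
  have hsum : (c / φ) ^ 2 + (c * φ) ^ 2 = 3 * c ^ 2 := by
    rw [hdiv]
    linear_combination 2 * c ^ 2 * hφ_sq
  rw [show R ^ 4 = (R ^ 2) ^ 2 by ring, show L ^ 4 = (L ^ 2) ^ 2 by ring, hR, hL]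
  generalize c / φ = p at *
  generalize c * φ = q at *
  have hd (a b e : ℝ) (h : a ^ 2 + b ^ 2 + e ^ 2 = 3 * c ^ 2) : d a b e ^ 10 =
      (3 * c ^ 2 + (x ^ 2 + y ^ 2 + z ^ 2) - 2 * (a * x + b * y + e * z)) ^ 5 :=
    sqrt_dist_sq_pow_ten x y z _ a b e h
  rw [hd c c c (by ring), hd c c (-c) (by ring),
    hd c (-c) c (by ring), hd c (-c) (-c) (by ring),
    hd (-c) c c (by ring), hd (-c) c (-c) (by ring),
    hd (-c) (-c) c (by ring), hd (-c) (-c) (-c) (by ring),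
    hd 0 p q (by linear_combination hsum), hd 0 p (-q) (by linear_combination hsum),
    hd 0 (-p) q (by linear_combination hsum), hd 0 (-p) (-q) (by linear_combination hsum),
    hd p q 0 (by linear_combination hsum), hd p (-q) 0 (by linear_combination hsum),
    hd (-p) q 0 (by linear_combination hsum), hd (-p) (-q) 0 (by linear_combination hsum),
    hd q 0 p (by linear_combination hsum), hd q 0 (-p) (by linear_combination hsum),
    hd (-q) 0 p (by linear_combination hsum), hd (-q) 0 (-p) (by linear_combination hsum),
    dodecahedron_sum_fifth_powers c p q x y z _ hsum hmul]
  ring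
end
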